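/- arXiv:2511.03002 — 2 statements merged into one kernel-verified Lean document; each statement's English description precedes it below -/
import Mathlib

section
/- Error-bounding system with filtered signals (Proposition 3). Suppose λ χ'ᵀ P χ' + 2 χ'ᵀ P (A χ' + B r') ≤ γ ‖C_f χ' + D_f r'‖² for all χ' ∈ ℝ^n, r' ∈ ℝ^m, and the block matrix [[γ I_p, C_z], [C_zᵀ, λ P]] is positive semidefinite. Let χ : [0,∞) → ℝ^n be differentiable with χ̇(t) = A χ(t) + B r(t), define the filtered output r_ψ(t) := C_f χ(t) + D_f r(t), and let δ : [0,∞) → ℝ be differentiable with δ̇(t) = −λ δ(t) + γ ‖r_ψ(t)‖² and δ(0) = χ(0)ᵀ P χ(0). Then for all t ≥ 0: (1/(λγ)) ‖C_z χ(t)‖² ≤ χ(t)ᵀ P χ(t) ≤ δ(t). -/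
open Matrix

theorem HasDerivAt.dotProduct_real {ι : Type*} [Fintype ι]
    {u v : ℝ → ι → ℝ} {u' v' : ι → ℝ} {t : ℝ}
    (hu : HasDerivAt u u' t) (hv : HasDerivAt v v' t) :
    HasDerivAt (fun s => u s ⬝ᵥ v s) (u' ⬝ᵥ v t + u t ⬝ᵥ v') t := by
  simp only [dotProduct, ← Finset.sum_add_distrib]
  exact HasDerivAt.fun_sum fun i _ => (hasDerivAt_pi.1 hu i).mul (hasDerivAt_pi.1 hv i)

theorem HasDerivAt.mulVec_const_real {ι κ : Type*} [Fintype ι] [Fintype κ]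
    (M : Matrix κ ι ℝ) {u : ℝ → ι → ℝ} {u' : ι → ℝ} {t : ℝ} (hu : HasDerivAt u u' t) :
    HasDerivAt (fun s => M *ᵥ u s) (M *ᵥ u') t := by
  refine hasDerivAt_pi.2 fun i => ?_
  simpa [mulVec] using (hasDerivAt_const t (M i)).dotProduct_real hu

theorem Matrix.IsSymm.dotProduct_mulVec_comm {ι : Type*} [Fintype ι] {P : Matrix ι ι ℝ}
    (hP : P.IsSymm) (x y : ι → ℝ) : x ⬝ᵥ (P *ᵥ y) = y ⬝ᵥ (P *ᵥ x) := by
  rw [dotProduct_mulVec, ← mulVec_transpose, hP.eq, dotProduct_comm]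

theorem HasDerivAt.quadraticForm_mulVec {ι : Type*} [Fintype ι] {P : Matrix ι ι ℝ}
    (hP : P.IsSymm) {u : ℝ → ι → ℝ} {u' : ι → ℝ} {t : ℝ} (hu : HasDerivAt u u' t) :
    HasDerivAt (fun s => u s ⬝ᵥ (P *ᵥ u s)) (2 * (u t ⬝ᵥ (P *ᵥ u'))) t := by
  convert hu.dotProduct_real (hu.mulVec_const_real P) using 1
  rw [hP.dotProduct_mulVec_comm u', two_mul]

/-- Schur-complement type consequence of positive semidefiniteness of a block matrix whose
upper-left block is a positive multiple of the identity. -/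
theorem Matrix.PosSemidef.dotProduct_self_mulVec_le_of_fromBlocks
    {ι κ : Type*} [Fintype ι] [Fintype κ] [DecidableEq κ]
    {C : Matrix κ ι ℝ} {P : Matrix ι ι ℝ} {l g : ℝ} (hg : 0 < g)
    (h : (Matrix.fromBlocks (g • (1 : Matrix κ κ ℝ)) C Cᵀ (l • P)).PosSemidef)
    (x : ι → ℝ) : (C *ᵥ x) ⬝ᵥ (C *ᵥ x) ≤ l * g * (x ⬝ᵥ (P *ᵥ x)) := by
  have key := h.dotProduct_mulVec_nonneg (Sum.elim (-(C *ᵥ x)) (g • x))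
  have hC : x ⬝ᵥ (Cᵀ *ᵥ (C *ᵥ x)) = (C *ᵥ x) ⬝ᵥ (C *ᵥ x) := by
    rw [mulVec_transpose, dotProduct_comm, ← dotProduct_mulVec]
  simp only [star_trivial, fromBlocks_mulVec, Sum.elim_comp_inl, Sum.elim_comp_inr, sumElim_dotProduct_sumElim,
    smul_mulVec, one_mulVec, mulVec_neg, mulVec_smul, dotProduct_add, neg_dotProduct, dotProduct_neg,
    smul_dotProduct, dotProduct_smul, smul_eq_mul, hC] at key
  have : 0 ≤ g * (l * g * (x ⬝ᵥ (P *ᵥ x)) - (C *ᵥ x) ⬝ᵥ (C *ᵥ x)) := by linarith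
  exact sub_nonneg.1 (nonneg_of_mul_nonneg_right this hg)

/-- A function with `f' ≥ -l f` on `[0, ∞)` and `f 0 ≥ 0` stays nonnegative. -/
theorem nonneg_of_hasDerivAt_ge_neg_mul {f f' : ℝ → ℝ} {l : ℝ}
    (hf : ∀ t, 0 ≤ t → HasDerivAt f (f' t) t) (hf' : ∀ t, 0 ≤ t → -l * f t ≤ f' t)
    (h0 : 0 ≤ f 0) {t : ℝ} (ht : 0 ≤ t) : 0 ≤ f t := by
  have hd : ∀ s, 0 ≤ s → HasDerivAt (fun s => Real.exp (l * s) * f s)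
      (Real.exp (l * s) * (l * 1) * f s + Real.exp (l * s) * f' s) s := fun s hs =>
    (((hasDerivAt_id s).const_mul l).exp).mul (hf s hs)
  have hmono : MonotoneOn (fun s => Real.exp (l * s) * f s) (Set.Ici 0) := by
    refine monotoneOn_of_deriv_nonneg (convex_Ici 0)
      (fun s hs => (hd s hs).continuousAt.continuousWithinAt) (fun s hs => ?_) fun s hs => ?_
    · exact (hd s (interior_subset hs)).differentiableAt.differentiableWithinAt
    · have hs' : 0 ≤ s := interior_subset hs
      rw [(hd s hs').deriv]
      have := mul_nonneg (Real.exp_pos (l * s)).le (sub_nonneg.2 (hf' s hs'))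
      linarith
  have h := hmono Set.self_mem_Ici ht ht
  simp only [mul_zero, Real.exp_zero, one_mul] at h
  exact nonneg_of_mul_nonneg_right (h0.trans h) (Real.exp_pos _)

/-- **Error-bounding system with filtered signals (Proposition 3).**
Suppose `λ χ'ᵀ P χ' + 2 χ'ᵀ P (A χ' + B r') ≤ γ ‖C_f χ' + D_f r'‖²` for all `χ', r'`,
and `[[γ I, C_z], [C_zᵀ, λ P]] ⪰ 0`. Let `χ` solve `χ̇ = A χ + B r`, set
`r_ψ := C_f χ + D_f r`, and let `δ` solve `δ̇ = −λ δ + γ ‖r_ψ‖²` with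
`δ(0) = χ(0)ᵀ P χ(0)`. Then for all `t ≥ 0`:
`(1/(λγ)) ‖C_z χ(t)‖² ≤ χ(t)ᵀ P χ(t) ≤ δ(t)`. -/
theorem filtered_error_bounding_system
    {n m q p : ℕ}
    (A : Matrix (Fin n) (Fin n) ℝ) (B : Matrix (Fin n) (Fin m) ℝ)
    (Cf : Matrix (Fin q) (Fin n) ℝ) (Df : Matrix (Fin q) (Fin m) ℝ)
    (Cz : Matrix (Fin p) (Fin n) ℝ)
    (P : Matrix (Fin n) (Fin n) ℝ) (hP : P.PosSemidef)
    (lam gam : ℝ) (hlam : 0 < lam) (hgam : 0 < gam)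
    (hdiss : ∀ (χ' : Fin n → ℝ) (r' : Fin m → ℝ),
      lam * (χ' ⬝ᵥ (P *ᵥ χ')) + 2 * (χ' ⬝ᵥ (P *ᵥ (A *ᵥ χ' + B *ᵥ r')))
        ≤ gam * ((Cf *ᵥ χ' + Df *ᵥ r') ⬝ᵥ (Cf *ᵥ χ' + Df *ᵥ r')))
    (hout : (Matrix.fromBlocks
        (gam • (1 : Matrix (Fin p) (Fin p) ℝ)) Cz Czᵀ (lam • P)).PosSemidef)
    (r : ℝ → Fin m → ℝ) (hr : Continuous r)
    (χ : ℝ → Fin n → ℝ)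
    (hχ : ∀ t : ℝ, 0 ≤ t → HasDerivAt χ (A *ᵥ χ t + B *ᵥ r t) t)
    (rψ : ℝ → Fin q → ℝ) (hrψ : ∀ t : ℝ, rψ t = Cf *ᵥ χ t + Df *ᵥ r t)
    (δ : ℝ → ℝ)
    (hδ : ∀ t : ℝ, 0 ≤ t → HasDerivAt δ (-lam * δ t + gam * (rψ t ⬝ᵥ rψ t)) t)
    (hδ0 : δ 0 = χ 0 ⬝ᵥ (P *ᵥ χ 0)) :
    ∀ t : ℝ, 0 ≤ t →
      (1 / (lam * gam)) * ((Cz *ᵥ χ t) ⬝ᵥ (Cz *ᵥ χ t)) ≤ χ t ⬝ᵥ (P *ᵥ χ t) ∧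
      χ t ⬝ᵥ (P *ᵥ χ t) ≤ δ t := by
  have hsymm : P.IsSymm := by simpa [IsHermitian, IsSymm] using hP.isHermitian
  intro t ht
  constructor
  · rw [one_div, inv_mul_le_iff₀ (mul_pos hlam hgam)]
    exact hout.dotProduct_self_mulVec_le_of_fromBlocks hgam (χ t)
  · refine sub_nonneg.1 (nonneg_of_hasDerivAt_ge_neg_mul (l := lam)
      (f := fun s => δ s - χ s ⬝ᵥ (P *ᵥ χ s))
      (fun s hs => (hδ s hs).sub ((hχ s hs).quadraticForm_mulVec hsymm)) (fun s _ => ?_)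
      (sub_nonneg.2 hδ0.ge) ht)
    have := hdiss (χ s) (r s)
    rw [← hrψ s] at this
    linarith
end

section
/- Filtered peak-to-peak gain bound (second claim of Proposition 3). Under the hypotheses of the filtered error-bounding system, if in addition ‖r_ψ(t)‖ ≤ R̄ for all t ≥ 0, then for all t ≥ 0: ‖C_z χ(t)‖² ≤ λ γ exp(−λ t) · χ(0)ᵀ P χ(0) + γ² R̄². In particular, sup_{t≥0} ‖C_z χ(t)‖² ≤ γ² · (sup_{t≥0} ‖r_ψ(t)‖)² + λ γ · χ(0)ᵀ P χ(0). -/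
open Matrix

/-- Comparison principle for the scalar dissipation inequality `a * V + V' ≤ c`. -/
theorem mul_le_exp_decay_of_hasDerivAt {V V' : ℝ → ℝ} {a c : ℝ} (ha : 0 < a)
    (hV : ∀ t, 0 ≤ t → HasDerivAt V (V' t) t) (hle : ∀ t, 0 ≤ t → a * V t + V' t ≤ c)
    {t : ℝ} (ht : 0 ≤ t) :
    a * V t ≤ a * Real.exp (-a * t) * V 0 + c * (1 - Real.exp (-a * t)) := by
  have hg : ∀ s, 0 ≤ s → HasDerivAt (fun s => Real.exp (a * s) * (V s - c / a))
      (Real.exp (a * s) * (a * V s + V' s - c)) s := by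
    intro s hs
    have he : HasDerivAt (fun s => Real.exp (a * s)) (Real.exp (a * s) * a) s := by
      simpa using ((hasDerivAt_id s).const_mul a).exp
    refine (he.mul ((hV s hs).sub_const (c / a))).congr_deriv ?_
    field_simp
    ring
  have hanti : AntitoneOn (fun s => Real.exp (a * s) * (V s - c / a)) (Set.Ici 0) := by
    refine antitoneOn_of_hasDerivWithinAt_nonpos (convex_Ici 0)
      (fun s hs => (hg s hs).continuousAt.continuousWithinAt)
      (fun s hs => (hg s (interior_subset hs)).hasDerivWithinAt) fun s hs => ?_
    exact mul_nonpos_of_nonneg_of_nonpos (Real.exp_pos _).le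
      (sub_nonpos.2 (hle s (interior_subset hs)))
  have h := hanti Set.self_mem_Ici ht ht
  simp only [mul_zero, Real.exp_zero, one_mul] at h
  have hV_le : V t - c / a ≤ Real.exp (-a * t) * (V 0 - c / a) := by
    rw [neg_mul, Real.exp_neg, inv_mul_eq_div, le_div_iff₀' (Real.exp_pos _)]
    exact h
  calc a * V t = a * (V t - c / a) + c := by field_simp; ring
    _ ≤ a * (Real.exp (-a * t) * (V 0 - c / a)) + c := by gcongr
    _ = _ := by field_simp; ring

theorem HasDerivAt.dotProduct {ι : Type*} [Fintype ι] {x y : ℝ → ι → ℝ} {x' y' : ι → ℝ} {t : ℝ}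
    (hx : HasDerivAt x x' t) (hy : HasDerivAt y y' t) :
    HasDerivAt (fun s => x s ⬝ᵥ y s) (x' ⬝ᵥ y t + x t ⬝ᵥ y') t := by
  simp only [_root_.dotProduct, ← Finset.sum_add_distrib]
  exact HasDerivAt.fun_sum fun i _ => (hasDerivAt_pi.1 hx i).mul (hasDerivAt_pi.1 hy i)

theorem HasDerivAt.matrix_mulVec {ι κ : Type*} [Fintype ι] [Fintype κ] (M : Matrix κ ι ℝ)
    {x : ℝ → ι → ℝ} {x' : ι → ℝ} {t : ℝ} (hx : HasDerivAt x x' t) :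
    HasDerivAt (fun s => M *ᵥ x s) (M *ᵥ x') t :=
  hasDerivAt_pi.2 fun i => by
    simpa [Matrix.mulVec] using (hasDerivAt_const t (M i)).dotProduct hx

/-- The derivative of a symmetric quadratic form along a differentiable curve. -/
theorem HasDerivAt.quadraticForm {ι : Type*} [Fintype ι] {P : Matrix ι ι ℝ} (hP : P.IsSymm)
    {x : ℝ → ι → ℝ} {x' : ι → ℝ} {t : ℝ} (hx : HasDerivAt x x' t) :
    HasDerivAt (fun s => x s ⬝ᵥ (P *ᵥ x s)) (2 * (x t ⬝ᵥ (P *ᵥ x'))) t := by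
  refine (hx.dotProduct (hx.matrix_mulVec P)).congr_deriv ?_
  rw [dotProduct_comm x', two_mul, add_left_inj, dotProduct_mulVec, ← mulVec_transpose, hP.eq]

/-- The Schur complement bound `‖C v‖² ≤ γ vᵀ Q v` given by a positive semidefinite block matrix. -/
theorem mulVec_dotProduct_self_le_of_posSemidef_fromBlocks {ι κ : Type*} [Fintype ι] [Fintype κ]
    [DecidableEq κ] {C : Matrix κ ι ℝ} {Q : Matrix ι ι ℝ} {γ : ℝ} (hγ : 0 < γ)
    (h : (Matrix.fromBlocks (γ • (1 : Matrix κ κ ℝ)) C Cᵀ Q).PosSemidef) (v : ι → ℝ) :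
    (C *ᵥ v) ⬝ᵥ (C *ᵥ v) ≤ γ * (v ⬝ᵥ (Q *ᵥ v)) := by
  have key := h.dotProduct_mulVec_nonneg (Sum.elim (-(C *ᵥ v)) (γ • v))
  have hC : v ⬝ᵥ (Cᵀ *ᵥ (C *ᵥ v)) = (C *ᵥ v) ⬝ᵥ (C *ᵥ v) := by
    rw [mulVec_transpose, dotProduct_comm, ← dotProduct_mulVec]
  rw [star_trivial, fromBlocks_mulVec, sumElim_dotProduct_sumElim] at key
  simp only [Sum.elim_comp_inl, mulVec_neg, smul_mulVec, one_mulVec, Sum.elim_comp_inr,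
    mulVec_smul, neg_add_cancel, dotProduct_zero, dotProduct_add, dotProduct_neg, smul_dotProduct,
    hC, smul_eq_mul, dotProduct_smul, zero_add, le_neg_add_iff_add_le, add_zero] at key
  exact le_of_mul_le_mul_left key hγ

/-- **Filtered peak-to-peak gain bound (second claim of Proposition 3).**
Under the hypotheses of the filtered error-bounding system, if in addition
`‖r_ψ(t)‖ ≤ R̄` for all `t ≥ 0`, then for all `t ≥ 0`:
`‖C_z χ(t)‖² ≤ λ γ exp(−λ t) χ(0)ᵀ P χ(0) + γ² R̄²`; in particular the peak of
`‖C_z χ‖²` is bounded by `γ² R̄² + λ γ χ(0)ᵀ P χ(0)`. -/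
theorem filtered_peak_to_peak_gain_bound
    {n m q p : ℕ}
    (A : Matrix (Fin n) (Fin n) ℝ) (B : Matrix (Fin n) (Fin m) ℝ)
    (Cf : Matrix (Fin q) (Fin n) ℝ) (Df : Matrix (Fin q) (Fin m) ℝ)
    (Cz : Matrix (Fin p) (Fin n) ℝ)
    (P : Matrix (Fin n) (Fin n) ℝ) (hP : P.PosSemidef)
    (lam gam : ℝ) (hlam : 0 < lam) (hgam : 0 < gam)
    (hdiss : ∀ (χ' : Fin n → ℝ) (r' : Fin m → ℝ),
      lam * (χ' ⬝ᵥ (P *ᵥ χ')) + 2 * (χ' ⬝ᵥ (P *ᵥ (A *ᵥ χ' + B *ᵥ r')))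
        ≤ gam * ((Cf *ᵥ χ' + Df *ᵥ r') ⬝ᵥ (Cf *ᵥ χ' + Df *ᵥ r')))
    (hout : (Matrix.fromBlocks
        (gam • (1 : Matrix (Fin p) (Fin p) ℝ)) Cz Czᵀ (lam • P)).PosSemidef)
    (r : ℝ → Fin m → ℝ) (hr : Continuous r)
    (χ : ℝ → Fin n → ℝ)
    (hχ : ∀ t : ℝ, 0 ≤ t → HasDerivAt χ (A *ᵥ χ t + B *ᵥ r t) t)
    (rψ : ℝ → Fin q → ℝ) (hrψ : ∀ t : ℝ, rψ t = Cf *ᵥ χ t + Df *ᵥ r t)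
    (Rbar : ℝ) (hRbar : ∀ t : ℝ, 0 ≤ t → Real.sqrt (rψ t ⬝ᵥ rψ t) ≤ Rbar) :
    (∀ t : ℝ, 0 ≤ t →
      (Cz *ᵥ χ t) ⬝ᵥ (Cz *ᵥ χ t)
        ≤ lam * gam * Real.exp (-lam * t) * (χ 0 ⬝ᵥ (P *ᵥ χ 0)) + gam ^ 2 * Rbar ^ 2) ∧
    (∀ t : ℝ, 0 ≤ t →
      (Cz *ᵥ χ t) ⬝ᵥ (Cz *ᵥ χ t)
        ≤ gam ^ 2 * Rbar ^ 2 + lam * gam * (χ 0 ⬝ᵥ (P *ᵥ χ 0))) := by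
  have hsq : ∀ t, 0 ≤ t → rψ t ⬝ᵥ rψ t ≤ Rbar ^ 2 := fun t ht =>
    (Real.sqrt_le_left ((Real.sqrt_nonneg _).trans (hRbar t ht))).1 (hRbar t ht)
  have hsymm : P.IsSymm := by simpa using hP.isHermitian
  have hdecay : ∀ t, 0 ≤ t → lam * (χ t ⬝ᵥ (P *ᵥ χ t)) ≤
      lam * Real.exp (-lam * t) * (χ 0 ⬝ᵥ (P *ᵥ χ 0)) +
        gam * Rbar ^ 2 * (1 - Real.exp (-lam * t)) := fun t ht =>
    mul_le_exp_decay_of_hasDerivAt hlam (V := fun t => χ t ⬝ᵥ (P *ᵥ χ t))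
      (fun s hs => (hχ s hs).quadraticForm hsymm)
      (fun s hs => (hdiss (χ s) (r s)).trans <| by
        rw [← hrψ]
        exact mul_le_mul_of_nonneg_left (hsq s hs) hgam.le) ht
  have hbound : ∀ t, 0 ≤ t → (Cz *ᵥ χ t) ⬝ᵥ (Cz *ᵥ χ t) ≤
      lam * gam * Real.exp (-lam * t) * (χ 0 ⬝ᵥ (P *ᵥ χ 0)) + gam ^ 2 * Rbar ^ 2 := by
    intro t ht
    have hz := mulVec_dotProduct_self_le_of_posSemidef_fromBlocks hgam hout (χ t)
    rw [smul_mulVec, dotProduct_smul, smul_eq_mul] at hz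
    have hd := mul_le_mul_of_nonneg_left (hdecay t ht) hgam.le
    have hpos : 0 ≤ gam ^ 2 * Rbar ^ 2 * Real.exp (-lam * t) := by positivity
    linarith
  refine ⟨hbound, fun t ht => (hbound t ht).trans ?_⟩
  have hV : 0 ≤ χ 0 ⬝ᵥ (P *ᵥ χ 0) := by simpa using hP.dotProduct_mulVec_nonneg (χ 0)
  have hexp : Real.exp (-lam * t) ≤ 1 := Real.exp_le_one_iff.2 (by nlinarith)
  have := mul_le_mul_of_nonneg_left hexp (by positivity : 0 ≤ lam * gam * (χ 0 ⬝ᵥ (P *ᵥ χ 0)))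
  linarith
end
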